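/- Let M, N, P ≥ 5 be odd integers and let D(M,N,P) = ⟨a,b,c ∣ a^M = b^N = c^P = abc = 1⟩ be the von Dyck group. Let C̄ be the subgroup of D(M,N,P) generated by a·b⁻¹ and c⁻¹·a. Then C̄ is malnormal in D(M,N,P): for every g ∈ D(M,N,P) with g ∉ C̄, the intersection g⁻¹C̄g ∩ C̄ is the trivial subgroup. -/

import Mathlib

/-- The relators of the von Dyck group D(M,N,P) = ⟨a,b,c ∣ a^M = b^N = c^P = abc = 1⟩,
with a = 0, b = 1, c = 2. -/
def vonDyckRels (M N P : ℕ) : Set (FreeGroup (Fin 3)) :=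
  {(FreeGroup.of 0) ^ M, (FreeGroup.of 1) ^ N, (FreeGroup.of 2) ^ P,
   FreeGroup.of 0 * FreeGroup.of 1 * FreeGroup.of 2}

/-- The von Dyck group D(M,N,P). -/
abbrev VonDyck (M N P : ℕ) : Type := PresentedGroup (vonDyckRels M N P)

namespace VD

/-- Germs at a vertex, counterclockwise: 0 = out a, 1 = in a, 2 = out b, 3 = in b. -/
def opp : Fin 4 → Fin 4 := ![1, 0, 3, 2]
def rho (x : Fin 4) : Fin 4 := opp x + 1
def lam (x : Fin 4) : Fin 4 := opp x + 3

/-- The core graph. -/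
def del : Fin 3 → Fin 4 → Option (Fin 3) :=
  ![![some 1, some 2, some 1, none], ![none, some 0, some 2, some 0],
    ![some 0, none, none, some 1]]

inductive V where
  | root (i : Fin 3) : V
  | node (p : V) (k : Bool) (i : ℕ) : V

open V

def two : V → Bool
  | root i => i == 2
  | node _ _ i => i != 0

def kk (k : Bool) : Fin 4 := if k then 1 else 0

def R : V → Fin 4
  | root i => (![2, 3, 0] : Fin 3 → Fin 4) i
  | node p k i => rho^[i + 1] (R p + 1 + kk k)

def up (p : V) (k : Bool) : Fin 4 := R p + 1 + kk k

def Lg (v : V) : Fin 4 := if two v then R v + 3 else R v + 2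

def beta : V → Bool → ℕ
  | _, true => 0
  | root i, false => (![2, 4, 2] : Fin 3 → ℕ) i
  | node _ _ _, false => 1

structure Good (L : Fin 4 → ℕ) : Prop where
  h5 : ∀ x, 5 ≤ L x
  h10 : 10 ≤ L 0
  h02 : L 2 = L 0
  hev : Even (L 0)

variable (L : Fin 4 → ℕ)

def cnt (p : V) (k : Bool) : ℕ := L (up p k) - 3 - beta p k

def succ : V → V
  | root i => root (i - 1)
  | node p k i => if i < cnt L p k then node p k (i + 1)
      else if k then node p false 0 else node (succ p) (two (succ p)) 0

def pred : V → V
  | root i => root (i + 1)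
  | node p k (i + 1) => node p k i
  | node p k 0 => if !k && two p then node p true (cnt L p true)
      else node (pred p) false (cnt L (pred p) false)

def slot (p : V) (k : Bool) : Prop := k = true → two p = true

def valid : V → Prop
  | root _ => True
  | node p k i => valid p ∧ slot p k ∧ i ≤ cnt L p k

def nb (v : V) (x : Fin 4) : V :=
  match v with
  | root i => match del i x with
    | some j => root j
    | none => node (root i) (x == R (root i) + 2) 0
  | node p k i =>
    if x = R (node p k i) then succ L (node p k i)
    else if x = R (node p k i) + 1 then node (node p k i) false 0
    else if x = R (node p k i) + 2 then
      (if i = 0 then pred L (node p k i) else node (node p k i) true 0)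
    else (if i = 0 then p else pred L (node p k i))

def isNode : V → Prop
  | root _ => False
  | node _ _ _ => True

variable {L}

theorem opp_opp (x : Fin 4) : opp (opp x) = x := by revert x; decide
theorem rho_rho (x : Fin 4) : rho (rho x) = x := by revert x; decide

theorem L_rho (hL : Good L) (x : Fin 4) : L (rho x) = L x := by
  have h := hL.h02
  have e : ∀ x : Fin 4, rho x = x ∨ (x = 0 ∧ rho x = 2) ∨ (x = 2 ∧ rho x = 0) := by decide
  rcases e x with h1 | ⟨h1, h2⟩ | ⟨h1, h2⟩
  · rw [h1]
  · rw [h2, h1, h]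
  · rw [h2, h1, h]

theorem rho_even (n : ℕ) (x : Fin 4) (h : Even n) : rho^[n] x = x := by
  obtain ⟨m, rfl⟩ := h
  induction m with
  | zero => rfl
  | succ m ih =>
    rw [show m + 1 + (m + 1) = (m + m) + 1 + 1 by ring, Function.iterate_succ_apply,
      Function.iterate_succ_apply, rho_rho, ih]

theorem rho_fix (n : ℕ) (x : Fin 4) (h : rho x = x) : rho^[n] x = x :=
  Function.iterate_fixed h n

theorem rho_L (hL : Good L) (x : Fin 4) : rho^[L x] x = x := by
  have e : ∀ x : Fin 4, rho x = x ∨ x = 0 ∨ x = 2 := by decide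
  rcases e x with h | h | h
  · exact rho_fix _ _ h
  · subst h; exact rho_even _ _ hL.hev
  · subst h; rw [hL.h02]; exact rho_even _ _ hL.hev

theorem L_big (hL : Good L) (x : Fin 4) : (rho x = x ∧ 5 ≤ L x) ∨ (rho x ≠ x ∧ 10 ≤ L x) := by
  have e : ∀ x : Fin 4, rho x = x ∨ rho x ≠ x ∧ (x = 0 ∨ x = 2) := by decide
  have h5 := hL.h5; have h10 := hL.h10; have h02 := hL.h02
  rcases e x with h | ⟨h0, h | h⟩
  · exact Or.inl ⟨h, h5 x⟩
  · exact Or.inr ⟨h0, by rw [h]; exact h10⟩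
  · exact Or.inr ⟨h0, by rw [h, h02]; exact h10⟩

theorem root1_up : up (root 1) false = 0 := by decide

theorem cnt_add (hL : Good L) (p : V) (k : Bool) : cnt L p k + 3 + beta p k = L (up p k) := by
  have h5 := hL.h5 (up p k)
  unfold cnt
  have : beta p k ≤ 2 ∨ (p = root 1 ∧ k = false) := by
    cases k
    · cases p with
      | root i => fin_cases i <;> simp [beta]
      | node p k i => simp [beta]
    · left; simp [beta]
  rcases this with h | ⟨rfl, rfl⟩
  · omega
  · rw [root1_up]; have := hL.h10; simp [beta]; omega

theorem R_node (p : V) (k : Bool) (i : ℕ) : R (node p k i) = rho^[i + 1] (up p k) := rfl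

theorem R_node_zero (p : V) (k : Bool) : R (node p k 0) = rho (up p k) := rfl

theorem R_node_succ (p : V) (k : Bool) (i : ℕ) :
    R (node p k (i + 1)) = rho (R (node p k i)) := by
  rw [R_node, R_node, Function.iterate_succ_apply']

theorem up_false (p : V) : up p false = R p + 1 := by simp [up, kk]
theorem up_true (p : V) : up p true = R p + 2 := by
  simp only [up, kk]; generalize R p = x; revert x; decide
theorem up_two (p : V) : up p (two p) = Lg p + 3 := by
  unfold Lg; cases h : two p
  · rw [up_false]; generalize R p = x; revert x; decide
  · rw [up_true]; generalize R p = x; revert x; decide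

theorem rcnt (hL : Good L) (p : V) (k : Bool) :
    rho^[cnt L p k + 2] (up p k) = if beta p k = 1 then up p k else rho (up p k) := by
  have h1 := cnt_add hL p k
  have h2 := rho_L hL (up p k)
  rw [← h1] at h2
  have hb : beta p k = 0 ∨ beta p k = 1 ∨ beta p k = 2 ∨ beta p k = 4 := by
    cases k
    · cases p with
      | root i => fin_cases i <;> simp [beta]
      | node p k i => simp [beta]
    · left; simp [beta]
  rcases hb with h | h | h | h <;> rw [h] at h2 ⊢ <;>
    simp only [Function.iterate_succ_apply', rho_rho, add_zero] at h2 ⊢ <;> simp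
  · exact (by rw [← h2, rho_rho]; simp [h2])
  · exact h2
  · rw [← h2, rho_rho]; simp [h2]
  · rw [← h2, rho_rho]; simp [h2]

/-- next slot -/
def nxt (L : Fin 4 → ℕ) (p : V) (k : Bool) : V × Bool :=
  if k then (p, false) else (succ L p, two (succ L p))

theorem succ_lt {p : V} {k : Bool} {i : ℕ} (h : i < cnt L p k) :
    succ L (node p k i) = node p k (i + 1) := by simp [succ, h]

theorem succ_last (p : V) (k : Bool) :
    succ L (node p k (cnt L p k)) = node (nxt L p k).1 (nxt L p k).2 0 := by
  cases k <;> simp [succ, nxt]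

theorem Lg_succ (hL : Good L) (v : V) (hn : isNode v) (hv : valid L v) :
    Lg (succ L v) = opp (R v) := by
  induction v with
  | root i => exact hn.elim
  | node p k i ih =>
    obtain ⟨hp, hs, hi⟩ := hv
    rcases hi.lt_or_eq with hlt | rfl
    · rw [succ_lt hlt]
      simp only [Lg, two, R_node_succ]
      generalize R (node p k i) = x
      revert x; simp; decide
    · rw [succ_last]
      have hr := rcnt hL p k
      rw [Function.iterate_succ_apply', ← R_node] at hr
      have hr2 := congrArg rho hr
      rw [rho_rho] at hr2
      rw [hr2]
      have hl : ∀ q k, Lg (node q k 0) = rho (up q k) + 2 := fun _ _ => rfl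
      rw [hl]
      cases k with
      | true =>
        simp only [nxt, if_true, up_false, up_true, beta]
        generalize R p = x; revert x; decide
      | false =>
        simp only [nxt, Bool.false_eq_true, if_false, up_two, up_false]
        cases p with
        | root j =>
          simp only [succ]
          clear hr hr2 ih hp hs hn hi
          revert j; decide
        | node q k' i' =>
          rw [ih trivial hp]
          simp only [beta, if_true]
          generalize R _ = x; revert x; decide

/-- The germ identity at the end of a face. -/
theorem face_end (hL : Good L) (p : V) (k : Bool) (hv : valid L p) (hs : slot p k) :
    rho (R (node p k (cnt L p k))) = opp (up (nxt L p k).1 (nxt L p k).2) := by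
  have h := Lg_succ hL (node p k (cnt L p k)) trivial ⟨hv, hs, le_rfl⟩
  rw [succ_last] at h
  have hl : ∀ q k, Lg (node q k 0) = rho (up q k) + 2 := fun _ _ => rfl
  rw [hl] at h
  generalize R (node p k (cnt L p k)) = x at *
  generalize up _ _ = y at *
  revert x y; decide

theorem valid_succ (v : V) (hv : valid L v) : valid L (succ L v) := by
  induction v with
  | root i => trivial
  | node p k i ih =>
    obtain ⟨hp, hs, hi⟩ := hv
    simp only [succ]
    split_ifs with h1 h2
    · exact ⟨hp, hs, h1⟩
    · exact ⟨hp, by simp [slot], Nat.zero_le _⟩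
    · exact ⟨ih hp, by simp [slot], Nat.zero_le _⟩

theorem valid_pred (v : V) (hv : valid L v) : valid L (pred L v) := by
  induction v with
  | root i => trivial
  | node p k i ih =>
    obtain ⟨hp, hs, hi⟩ := hv
    cases i with
    | succ i => exact ⟨hp, hs, by omega⟩
    | zero =>
      simp only [pred]
      split_ifs with h1
      · exact ⟨hp, by simp at h1; simp [slot, h1], le_rfl⟩
      · exact ⟨ih hp, by simp [slot], le_rfl⟩

theorem pred_succ (v : V) (hv : valid L v) : pred L (succ L v) = v := by
  induction v with
  | root i => simp [pred, succ]
  | node p k i ih =>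
    obtain ⟨hp, hs, hi⟩ := hv
    rcases hi.lt_or_eq with hlt | rfl
    · rw [succ_lt hlt]; rfl
    · rw [succ_last]
      cases k
      · simp [nxt, pred, ih hp]
      · simp [nxt, pred, hs rfl]

theorem succ_pred (v : V) (hv : valid L v) : succ L (pred L v) = v := by
  induction v with
  | root i => simp [pred, succ]
  | node p k i ih =>
    obtain ⟨hp, hs, hi⟩ := hv
    cases i with
    | succ i => simp [pred, succ]; omega
    | zero =>
      simp only [pred]
      split_ifs with h1
      · simp at h1; simp [succ, h1]
      · simp only [succ, lt_irrefl, if_false, ih hp]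
        cases k <;> simp_all [slot]

theorem isNode_pred (v : V) (h : isNode v) : isNode (pred L v) := by
  cases v with
  | root i => exact h
  | node p k i =>
    cases i with
    | succ i => trivial
    | zero => simp only [pred]; split_ifs <;> trivial

theorem isNode_succ (v : V) (h : isNode v) : isNode (succ L v) := by
  cases v with
  | root i => exact h
  | node p k i => simp only [succ]; split_ifs <;> trivial

theorem R_pred (hL : Good L) (v : V) (hn : isNode v) (hv : valid L v) :
    R (pred L v) = opp (Lg v) := by
  have h := Lg_succ hL (pred L v) (isNode_pred v hn) (valid_pred v hv)
  rw [succ_pred v hv] at h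
  rw [h, opp_opp]

theorem nb_right (v : V) (hn : isNode v) : nb L v (R v) = succ L v := by
  cases v with
  | root i => exact hn.elim
  | node p k i => simp [nb]

theorem nb_left (v : V) (hn : isNode v) : nb L v (Lg v) = pred L v := by
  cases v with
  | root i => exact hn.elim
  | node p k i =>
    have h : ∀ x : Fin 4, x + 2 ≠ x ∧ x + 2 ≠ x + 1 ∧ x + 3 ≠ x ∧ x + 3 ≠ x + 1 ∧ x + 3 ≠ x + 2 := by
      decide
    obtain ⟨h1, h2, h3, h4, h5⟩ := h (R (node p k i))
    by_cases hi : i = 0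
    · simp [nb, Lg, two, hi]
    · simp [nb, Lg, two, hi, h3]

theorem nb_up (v : V) (k : Bool) (hs : slot v k) : nb L v (up v k) = node v k 0 := by
  cases v with
  | root i =>
    fin_cases i <;> cases k <;> first | rfl | (exact absurd (hs rfl) (by decide))
  | node p k' i =>
    have h : ∀ x : Fin 4, x + 2 ≠ x ∧ x + 2 ≠ x + 1 ∧ x + 1 ≠ x := by
      decide
    obtain ⟨h1, h2, h3⟩ := h (R (node p k' i))
    cases k
    · rw [up_false]; simp [nb]
    · rw [up_true]; have := hs rfl; simp [two] at this; simp [nb, this, h1]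

theorem nb_down (p : V) (k : Bool) : nb L (node p k 0) (opp (up p k)) = p := by
  have h : ∀ x : Fin 4, opp x ≠ rho x ∧ opp x ≠ rho x + 1 ∧ opp x ≠ rho x + 2 := by decide
  obtain ⟨h1, h2, h3⟩ := h (up p k)
  simp [nb, R_node_zero, h1, h2, h3]

theorem nb_core (i j : Fin 3) (x : Fin 4) (h : del i x = some j) : nb L (root i) x = root j := by
  simp [nb, h]

theorem germ_cases (v : V) (x : Fin 4) :
    (isNode v ∧ x = R v) ∨ (isNode v ∧ x = Lg v) ∨ (∃ k, slot v k ∧ x = up v k) ∨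
    (∃ p k, v = node p k 0 ∧ x = opp (up p k)) ∨ (∃ i j, v = root i ∧ del i x = some j) := by
  cases v with
  | root i =>
    have h : (∃ j, del i x = some j) ∨ ∃ k, (k = true → (i == 2) = true) ∧ x = up (root i) k := by
      revert i x; decide
    rcases h with ⟨j, h⟩ | h
    · exact Or.inr (Or.inr (Or.inr (Or.inr ⟨i, j, rfl, h⟩)))
    · exact Or.inr (Or.inr (Or.inl h))
  | node p k i =>
    have h : ∀ x y : Fin 4, x = y ∨ x = y + 1 ∨ x = y + 2 ∨ x = y + 3 := by decide
    have ho : ∀ x : Fin 4, rho x + 3 = opp x := by decide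
    rcases h x (R (node p k i)) with h | h | h | h
    · exact Or.inl ⟨trivial, h⟩
    · exact Or.inr (Or.inr (Or.inl ⟨false, by simp [slot], by rw [up_false, h]⟩))
    · by_cases hi : i = 0
      · exact Or.inr (Or.inl ⟨trivial, by simp [Lg, two, hi] at *; exact h⟩)
      · exact Or.inr (Or.inr (Or.inl ⟨true, by simp [slot, two, hi], by rw [up_true, h]⟩))
    · by_cases hi : i = 0
      · subst hi
        exact Or.inr (Or.inr (Or.inr (Or.inl ⟨p, k, rfl, by rw [h, R_node_zero, ho]⟩)))
      · exact Or.inr (Or.inl ⟨trivial, by simp [Lg, two, hi] at *; exact h⟩)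

theorem valid_nb (v : V) (x : Fin 4) (hv : valid L v) : valid L (nb L v x) := by
  rcases germ_cases v x with ⟨hn, rfl⟩ | ⟨hn, rfl⟩ | ⟨k, hs, rfl⟩ | ⟨p, k, rfl, rfl⟩ |
    ⟨i, j, rfl, h⟩
  · rw [nb_right v hn]; exact valid_succ v hv
  · rw [nb_left v hn]; exact valid_pred v hv
  · rw [nb_up v k hs]; exact ⟨hv, hs, Nat.zero_le _⟩
  · rw [nb_down]; exact hv.1
  · rw [nb_core i j x h]; trivial

theorem del_opp (i j : Fin 3) (x : Fin 4) (h : del i x = some j) : del j (opp x) = some i := by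
  revert i j x; decide

theorem nb_nb (hL : Good L) (v : V) (x : Fin 4) (hv : valid L v) :
    nb L (nb L v x) (opp x) = v := by
  rcases germ_cases v x with ⟨hn, rfl⟩ | ⟨hn, rfl⟩ | ⟨k, hs, rfl⟩ | ⟨p, k, rfl, rfl⟩ |
    ⟨i, j, rfl, h⟩
  · rw [nb_right v hn, ← Lg_succ hL v hn hv, nb_left _ (isNode_succ v hn), pred_succ v hv]
  · rw [nb_left v hn, ← R_pred hL v hn hv, nb_right _ (isNode_pred v hn), succ_pred v hv]
  · rw [nb_up v k hs, nb_down]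
  · rw [nb_down, opp_opp, nb_up p k hv.2.1]
  · rw [nb_core i j x h, nb_core j i _ (del_opp i j x h)]

/-! ### Faces close up -/

def phi (L : Fin 4 → ℕ) (d : V × Fin 4) : V × Fin 4 := (nb L d.1 d.2, rho d.2)

def Per (L : Fin 4 → ℕ) (v : V) (x : Fin 4) : Prop := (phi L)^[L x] (v, x) = (v, x)

theorem phi_snd (n : ℕ) (d : V × Fin 4) : ((phi L)^[n] d).2 = rho^[n] d.2 := by
  induction n with
  | zero => rfl
  | succ n ih => rw [Function.iterate_succ_apply', Function.iterate_succ_apply', ← ih]; rfl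

theorem phi_valid (n : ℕ) (d : V × Fin 4) (h : valid L d.1) : valid L ((phi L)^[n] d).1 := by
  induction n with
  | zero => exact h
  | succ n ih => rw [Function.iterate_succ_apply']; exact valid_nb _ _ ih

theorem phi_inj (hL : Good L) (d e : V × Fin 4) (hd : valid L d.1) (he : valid L e.1)
    (h : phi L d = phi L e) : d = e := by
  obtain ⟨v, x⟩ := d
  obtain ⟨w, y⟩ := e
  simp only [phi, Prod.mk.injEq] at h
  have hxy : x = y := by rw [← rho_rho x, h.2, rho_rho]
  subst hxy
  have := congrArg (fun z => nb L z (opp x)) h.1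
  simp only [nb_nb hL _ _ hd, nb_nb hL _ _ he] at this
  rw [this]

theorem per_of_phi (hL : Good L) (v : V) (x : Fin 4) (hv : valid L v)
    (h : Per L (nb L v x) (rho x)) : Per L v x := by
  unfold Per at *
  rw [L_rho hL] at h
  apply phi_inj hL _ _ (phi_valid _ _ hv) hv
  rw [← Function.iterate_succ_apply' (phi L), Function.iterate_succ_apply]
  exact h

theorem per_phi (hL : Good L) (v : V) (x : Fin 4)
    (h : Per L v x) : Per L (nb L v x) (rho x) := by
  unfold Per at *
  rw [L_rho hL]
  have : (nb L v x, rho x) = phi L (v, x) := rfl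
  rw [this, ← Function.iterate_succ_apply, Function.iterate_succ_apply', h]

theorem per_iter (hL : Good L) (v : V) (x : Fin 4) (h : Per L v x) (n : ℕ) :
    Per L ((phi L)^[n] (v, x)).1 ((phi L)^[n] (v, x)).2 := by
  induction n with
  | zero => exact h
  | succ n ih => rw [Function.iterate_succ_apply']; exact per_phi hL _ _ ih

theorem walk_face (p : V) (k : Bool) (hs : slot p k) (j : ℕ) (hj : j ≤ cnt L p k) :
    (phi L)^[j + 1] (p, up p k) = (node p k j, R (node p k j)) := by
  induction j with
  | zero => simp [phi, nb_up p k hs, R_node_zero]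
  | succ j ih =>
    rw [Function.iterate_succ_apply', ih (by omega)]
    simp only [phi]
    rw [nb_right (node p k j) trivial, succ_lt (by omega), R_node_succ]

theorem per_slot (hL : Good L) (p : V) (k : Bool) (hv : valid L p) (hs : slot p k) :
    Per L p (up p k) := by
  unfold Per
  refine Prod.ext ?_ (by rw [phi_snd]; exact rho_L hL _)
  rw [← cnt_add hL]
  have h1 := walk_face p k hs (cnt L p k) le_rfl
  have h2 : (phi L)^[cnt L p k + 3] (p, up p k) =
      ((nxt L p k).1, rho (opp (up (nxt L p k).1 (nxt L p k).2))) := by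
    rw [Function.iterate_succ_apply', Function.iterate_succ_apply', h1]
    simp only [phi]
    rw [nb_right (node p k _) trivial, succ_last, face_end hL p k hv hs, nb_down]
  rw [add_comm _ (beta p k), Function.iterate_add_apply, h2]
  cases k with
  | true => simp [beta, nxt]
  | false =>
    simp only [nxt, Bool.false_eq_true, if_false, up_two]
    have ho : ∀ x : Fin 4, rho (opp (x + 3)) = x := by decide
    rw [ho]
    cases p with
    | root i =>
      fin_cases i
      · change ((phi L)^[2] (root 2, 3)).1 = root 0
        rfl
      · change ((phi L)^[4] (root 0, 0)).1 = root 1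
        rfl
      · change ((phi L)^[2] (root 1, 1)).1 = root 2
        rfl
    | node q k i =>
      simp only [beta, Function.iterate_one, phi]
      rw [nb_left _ (isNode_succ (node q k i) trivial), pred_succ _ hv]

theorem per_left (hL : Good L) (v : V) (hn : isNode v) (hv : valid L v) : Per L v (Lg v) := by
  apply per_of_phi hL _ _ hv
  rw [nb_left v hn]
  have : rho (Lg v) = up (pred L v) false := by rw [up_false, R_pred hL v hn hv]; rfl
  rw [this]
  exact per_slot hL _ _ (valid_pred v hv) (by simp [slot])

theorem per_root (hL : Good L) (i : Fin 3) (x : Fin 4) : Per L (root i) x := by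
  have h03 : Per L (root 0) 3 := per_slot hL (root 0) false trivial (by simp [slot])
  have h10 : Per L (root 1) 0 := per_slot hL (root 1) false trivial (by simp [slot])
  have h21 : Per L (root 2) 1 := per_slot hL (root 2) false trivial (by simp [slot])
  have h22 : Per L (root 2) 2 := per_slot hL (root 2) true trivial (by simp [slot, two])
  have h02 : Per L (root 0) 2 := per_of_phi hL _ _ trivial h10
  have h20 : Per L (root 2) 0 := per_of_phi hL _ _ trivial h02
  have h12 : Per L (root 1) 2 := per_of_phi hL _ _ trivial h20
  have h00 : Per L (root 0) 0 := per_of_phi hL _ _ trivial h12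
  have h01 : Per L (root 0) 1 := per_of_phi hL _ _ trivial h21
  have h11 : Per L (root 1) 1 := per_of_phi hL _ _ trivial h01
  have h13 : Per L (root 1) 3 := per_of_phi hL _ _ trivial h03
  have h23 : Per L (root 2) 3 := per_of_phi hL _ _ trivial h13
  fin_cases i <;> fin_cases x <;> assumption

theorem per_all (hL : Good L) (v : V) (x : Fin 4) (hv : valid L v) : Per L v x := by
  rcases germ_cases v x with ⟨hn, rfl⟩ | ⟨hn, rfl⟩ | ⟨k, hs, rfl⟩ | ⟨p, k, rfl, rfl⟩ |
    ⟨i, j, rfl, h⟩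
  · cases v with
    | root i => exact hn.elim
    | node p k i =>
      have h := per_iter hL p (up p k) (per_slot hL p k hv.1 hv.2.1) (i + 1)
      rw [walk_face p k hv.2.1 i hv.2.2] at h
      exact h
  · exact per_left hL v hn hv
  · exact per_slot hL v k hv hs
  · apply per_of_phi hL _ _ hv
    rw [nb_down]
    cases p with
    | root i => exact per_root hL _ _
    | node q k' i' =>
      have ho : ∀ x : Fin 4, rho (opp x) = x + 1 := by decide
      rw [ho]
      by_cases hk : k = two (node q k' i')
      · rw [hk, up_two, show Lg (node q k' i') + 3 + 1 = Lg (node q k' i') by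
          generalize Lg _ = x; revert x; decide]
        exact per_left hL _ trivial hv.1
      · have hk0 : k = false := by
          cases k
          · rfl
          · exact absurd (hv.2.1 rfl).symm hk
        have ht : two (node q k' i') = true := by
          subst hk0; simpa using hk
        have := per_slot hL (node q k' i') true hv.1 (fun _ => ht)
        rw [hk0, up_false]
        rw [up_true] at this
        convert this using 1
        generalize R _ = x; revert x; decide
  · exact per_root hL _ _

/-! ### Coset representatives -/

section cosets
variable {G : Type*} [Group G]

def pth (g : Fin 4 → G) (x : Fin 4) : ℕ → G
  | 0 => 1
  | n + 1 => pth g x n * g (rho^[n] x)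

theorem pth_add (g : Fin 4 → G) (x : Fin 4) (m n : ℕ) :
    pth g x (m + n) = pth g x m * pth g (rho^[m] x) n := by
  induction n with
  | zero => simp [pth]
  | succ n ih =>
    rw [← add_assoc]
    simp only [pth, ih, mul_assoc]
    rw [add_comm m n, Function.iterate_add_apply]

def W (g : Fin 4 → G) (w : Fin 3 → G) : V → G
  | root i => w i
  | node p k i => W g w p * pth g (up p k) (i + 1)

variable {g : Fin 4 → G} {w : Fin 3 → G} {H : Subgroup G}

theorem W_rev (hg : ∀ x, g (opp x) = (g x)⁻¹) (A B : G) (x : Fin 4)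
    (h : A * g x * B⁻¹ ∈ H) : B * g (opp x) * A⁻¹ ∈ H := by
  have := H.inv_mem h
  rw [hg]
  simpa [mul_assoc] using this

theorem W_comp {A B C x y : G} (h : A * x * B⁻¹ ∈ H) (h' : B * y * C⁻¹ ∈ H) :
    A * (x * y) * C⁻¹ ∈ H := by
  have := H.mul_mem h h'
  simpa [mul_assoc] using this

theorem W_right (hL : Good L) (hg : ∀ x, g (opp x) = (g x)⁻¹) (hr : ∀ x, pth g x (L x) = 1)
    (hw : ∀ i j x, del i x = some j → w i * g x * (w j)⁻¹ ∈ H)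
    (v : V) (hn : isNode v) (hv : valid L v) :
    W g w v * g (R v) * (W g w (succ L v))⁻¹ ∈ H := by
  induction v with
  | root i => exact hn.elim
  | node p k i ih =>
    obtain ⟨hp, hs, hi⟩ := hv
    rcases hi.lt_or_eq with hlt | rfl
    · rw [succ_lt hlt]
      simp only [W, R_node]
      rw [show pth g (up p k) (i + 1 + 1) = pth g (up p k) (i + 1) * g (rho^[i + 1] (up p k))
        from rfl]
      rw [← mul_assoc (W g w p), mul_inv_cancel]
      exact H.one_mem
    · have hend := face_end hL p k hp hs
      rw [R_node, ← Function.iterate_succ_apply' rho] at hend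
      rw [succ_last]
      have h1 := hr (up p k)
      rw [← cnt_add hL, pth_add, Function.iterate_succ_apply', hend,
        show pth g (up p k) (cnt L p k + 3) =
          pth g (up p k) (cnt L p k + 1) * g (rho^[cnt L p k + 1] (up p k)) *
            g (rho^[cnt L p k + 1 + 1] (up p k)) from rfl, hend, hg] at h1
      simp only [W, R_node]
      set X := pth g (up p k) (cnt L p k + 1) * g (rho^[cnt L p k + 1] (up p k)) with hX
      set B := pth g (rho (opp (up (nxt L p k).1 (nxt L p k).2))) (beta p k) with hB
      set U := g (up (nxt L p k).1 (nxt L p k).2) with hU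
      have hp1 : pth g (up (nxt L p k).1 (nxt L p k).2) (0 + 1) = U := by simp [pth, hU]
      rw [hp1, mul_assoc (W g w p), ← hX]
      have hX2 : X = B⁻¹ * U := by
        rw [mul_assoc] at h1
        rw [eq_inv_of_mul_eq_one_left h1]; simp
      rw [hX2]
      suffices hh : W g w (nxt L p k).1 * B * (W g w p)⁻¹ ∈ H by
        have := H.inv_mem hh
        simpa [mul_assoc] using this
      cases k with
      | true => simp [hB, beta, nxt, pth, H.one_mem]
      | false =>
        rw [hB]
        simp only [nxt, Bool.false_eq_true, if_false, up_two]
        have ho : ∀ x : Fin 4, rho (opp (x + 3)) = x := by decide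
        rw [ho]
        cases p with
        | root i =>
          fin_cases i
          · have h1 := hw 2 1 3 rfl
            have h2 := hw 1 0 3 rfl
            have := W_comp h1 h2
            change w 2 * (1 * g 3 * g 3) * (w 0)⁻¹ ∈ H
            simpa using this
          · have h1 := hw 0 1 0 rfl
            have h2 := hw 1 2 2 rfl
            have h3 := hw 2 0 0 rfl
            have h4 := hw 0 1 2 rfl
            have := W_comp (W_comp (W_comp h1 h2) h3) h4
            have e : pth g 0 4 = g 0 * g 2 * g 0 * g 2 := by
              simp only [pth, one_mul]; rfl
            change w 0 * (pth g 0 4) * (w 1)⁻¹ ∈ H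
            rw [e]
            simpa [mul_assoc] using this
          · have h1 := hw 1 0 1 rfl
            have h2 := hw 0 2 1 rfl
            have := W_comp h1 h2
            change w 1 * (1 * g 1 * g 1) * (w 2)⁻¹ ∈ H
            simpa using this
        | node q k i =>
          have := W_rev hg _ _ _ (ih trivial hp)
          rw [← Lg_succ hL (node q k i) trivial hp] at this
          simpa [beta, pth] using this

theorem W_nb (hL : Good L) (hg : ∀ x, g (opp x) = (g x)⁻¹) (hr : ∀ x, pth g x (L x) = 1)
    (hw : ∀ i j x, del i x = some j → w i * g x * (w j)⁻¹ ∈ H)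
    (v : V) (x : Fin 4) (hv : valid L v) :
    W g w v * g x * (W g w (nb L v x))⁻¹ ∈ H := by
  rcases germ_cases v x with ⟨hn, rfl⟩ | ⟨hn, rfl⟩ | ⟨k, hs, rfl⟩ | ⟨p, k, rfl, rfl⟩ |
    ⟨i, j, rfl, h⟩
  · rw [nb_right v hn]; exact W_right hL hg hr hw v hn hv
  · rw [nb_left v hn]
    have := W_rev hg _ _ _ (W_right hL hg hr hw (pred L v) (isNode_pred v hn) (valid_pred v hv))
    rw [succ_pred v hv, R_pred hL v hn hv, opp_opp] at this
    exact this
  · rw [nb_up v k hs]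
    simp [W, pth, H.one_mem]
  · rw [nb_down]
    simp [W, pth, hg, H.one_mem]
  · rw [nb_core i j x h]; exact hw i j x h

end cosets

/-! ### Ascending paths keep ascending -/

def ht : V → ℕ
  | root _ => 0
  | node p _ _ => ht p + 1

theorem ht_succ (v : V) : ht (succ L v) = ht v := by
  induction v with
  | root i => rfl
  | node p k i ih => simp only [succ]; split_ifs <;> simp [ht, ih]

theorem ht_pred (v : V) : ht (pred L v) = ht v := by
  induction v with
  | root i => rfl
  | node p k i ih =>
    cases i with
    | succ i => rfl
    | zero => simp only [pred]; split_ifs <;> simp [ht, ih]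

/-- Length of the longest clockwise (resp. counterclockwise) face walk in the core graph. -/
def remR : Fin 3 → Fin 4 → ℕ := ![![4, 1, 1, 0], ![0, 2, 3, 1], ![2, 0, 0, 2]]
def remL : Fin 3 → Fin 4 → ℕ := ![![1, 3, 2, 0], ![0, 1, 1, 4], ![2, 0, 0, 2]]

theorem remR_step (j j' : Fin 3) (x : Fin 4) (h : del j x = some j') :
    remR j x = remR j' (rho x) + 1 := by revert j j' x; decide
theorem remL_step (j j' : Fin 3) (x : Fin 4) (h : del j x = some j') :
    remL j x = remL j' (lam x) + 1 := by revert j j' x; decide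
theorem remR_le (j : Fin 3) (x : Fin 4) : remR j x ≤ 4 ∧ (rho x = x → remR j x ≤ 2) := by
  revert j x; decide
theorem remL_le (j : Fin 3) (x : Fin 4) :
    remL j x ≤ 4 ∧ (rho (opp x) = opp x → remL j x ≤ 2) := by
  revert j x; decide

theorem cnt_ge (hL : Good L) (p : V) (k : Bool) :
    (rho (up p k) ≠ up p k → 3 ≤ cnt L p k) ∧
    (1 ≤ cnt L p k ∨ (cnt L p k = 0 ∧ k = false ∧ (p = root 0 ∨ p = root 2))) := by
  have h1 := cnt_add hL p k
  cases k with
  | true =>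
    simp only [beta] at h1
    rcases L_big hL (up p true) with ⟨h2, h3⟩ | ⟨h2, h3⟩
    · exact ⟨fun h => absurd h2 h, Or.inl (by omega)⟩
    · exact ⟨fun _ => by omega, Or.inl (by omega)⟩
  | false =>
    cases p with
    | node q k i =>
      simp only [beta] at h1
      rcases L_big hL (up (node q k i) false) with ⟨h2, h3⟩ | ⟨h2, h3⟩
      · exact ⟨fun h => absurd h2 h, Or.inl (by omega)⟩
      · exact ⟨fun _ => by omega, Or.inl (by omega)⟩
    | root i =>
      rcases L_big hL (up (root i) false) with ⟨h2, h3⟩ | ⟨h2, h3⟩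
      · refine ⟨fun h => absurd h2 h, ?_⟩
        have : i = 0 ∨ i = 2 := by revert h2; clear h1 h3; revert i; decide
        rcases this with rfl | rfl <;> simp <;> omega
      · have : i = 1 := by revert h2; clear h1 h3; revert i; decide
        subst this
        simp only [beta] at h1
        simp at h1
        exact ⟨fun _ => by omega, Or.inl (by omega)⟩

theorem cnt_two_true (hL : Good L) : 7 ≤ cnt L (root 2) true := by
  have h1 := cnt_add hL (root 2) true
  have h2 : up (root 2) true = 2 := by decide
  have := hL.h10
  have := hL.h02
  rw [h2] at h1; simp only [beta] at h1; omega

inductive Asc (L : Fin 4 → ℕ) : V → Fin 3 → Fin 4 → Prop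
  | a0 (p : V) (k : Bool) (j0 j : Fin 3) (h : del j0 (up p k) = some j) :
      Asc L (node p k 0) j (up p k)
  | ar (p : V) (k : Bool) (i : ℕ) (j : Fin 3) (l : Fin 4) (hl : opp l = Lg (node p k i))
      (h : remR j (R (node p k i)) + i ≤ cnt L p k)
      (h0 : i = 0 → del j (opp (up p k)) = none) : Asc L (node p k i) j l
  | al (p : V) (k : Bool) (i : ℕ) (j : Fin 3) (l : Fin 4) (hl : opp l = R (node p k i))
      (h : remL j (Lg (node p k i)) < i) : Asc L (node p k i) j l
  | ax2 (l : Fin 4) (hl : opp l = R (node (root 2) false 0)) :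
      Asc L (node (root 2) false 0) 1 l
  | ax0 (l : Fin 4) (hl : opp l = R (node (root 0) false 0)) :
      Asc L (node (root 0) false 0) 2 l

theorem two_eq_of_fix (p : V) (k : Bool) (i : ℕ) :
    rho (R (node p k i)) = R (node p k i) ↔ rho (up p k) = up p k := by
  rw [R_node]
  induction i with
  | zero => simp [rho_rho, eq_comm]
  | succ i ih =>
    rw [Function.iterate_succ_apply', rho_rho]
    rw [← ih, eq_comm]

theorem asc_right (hL : Good L) (v : V) (j j' : Fin 3) (l : Fin 4) (hn : isNode v)
    (hv : valid L v) (ha : Asc L v j l) (hd : del j (R v) = some j') (hx : R v ≠ opp l) :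
    Asc L (succ L v) j' (R v) := by
  have hLg := Lg_succ hL v hn hv
  cases ha with
  | a0 p k j0 _ h =>
    have hc := cnt_ge hL p k
    rcases hc.2 with h1 | ⟨h1, rfl, rfl | rfl⟩
    · rw [succ_lt (by omega)] at hLg ⊢
      have e1 := remR_step _ _ _ h
      rw [← R_node_zero] at e1
      have e2 := remR_step _ _ _ hd
      rw [← R_node_succ] at e2
      have e3 := remR_le j0 (up p k)
      refine Asc.ar _ _ _ _ _ hLg.symm ?_ (by simp)
      by_cases hr : rho (up p k) = up p k
      · have := e3.2 hr; simp at *; omega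
      · have := hc.1 hr; simp at *; omega
    · have hs := succ_last (L := L) (root 0) false
      rw [h1] at hs
      rw [hs] at hLg ⊢
      have hj : j' = 0 := by
        clear hLg hs hx; revert h hd; revert j0 j j'; decide
      subst hj
      refine Asc.ar _ _ _ _ _ hLg.symm ?_ ?_
      · have := cnt_two_true hL
        have e : nxt L (root 0) false = (root 2, true) := by
          simp only [nxt, succ, show (0 - 1 : Fin 3) = 2 by decide]; rfl
        rw [e]
        have e2 : remR 0 (R (node (root 2) true 0)) = 4 := by decide
        rw [e2]
        dsimp only
        omega
      · intro _
        have e : nxt L (root 0) false = (root 2, true) := by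
          simp only [nxt, succ, show (0 - 1 : Fin 3) = 2 by decide]; rfl
        rw [e]; decide
    · have hs := succ_last (L := L) (root 2) false
      rw [h1] at hs
      rw [hs] at hLg ⊢
      have hj : j' = 2 := by
        clear hLg hs hx; revert h hd; revert j0 j j'; decide
      subst hj
      refine Asc.ar _ _ _ _ _ hLg.symm ?_ ?_
      · have e : nxt L (root 2) false = (root 1, false) := by
          simp only [nxt, succ, show (2 - 1 : Fin 3) = 1 by decide]; rfl
        rw [e]
        have e2 : remR 2 (R (node (root 1) false 0)) = 0 := by decide
        rw [e2]
        dsimp only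
        omega
      · intro _
        have e : nxt L (root 2) false = (root 1, false) := by
          simp only [nxt, succ, show (2 - 1 : Fin 3) = 1 by decide]; rfl
        rw [e]; decide
  | ar p k i _ _ hl h h0 =>
    have e2 := remR_step _ _ _ hd
    rw [← R_node_succ] at e2
    rw [succ_lt (by omega)] at hLg ⊢
    exact Asc.ar _ _ _ _ _ hLg.symm (by omega) (by simp)
  | al p k i _ _ hl h => exact absurd hl.symm hx
  | ax2 _ hl => exact absurd hl.symm hx
  | ax0 _ hl => exact absurd hl.symm hx

theorem asc_left (hL : Good L) (v : V) (j j' : Fin 3) (l : Fin 4) (hn : isNode v)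
    (hv : valid L v) (ha : Asc L v j l) (hd : del j (Lg v) = some j') (hx : Lg v ≠ opp l) :
    Asc L (pred L v) j' (Lg v) := by
  have hR := R_pred hL v hn hv
  cases ha with
  | a0 p k j0 _ h =>
    have hsp := succ_pred _ hv
    have hvp := valid_pred _ hv
    have hlast : ∃ q k', pred L (node p k 0) = node q k' (cnt L q k') := by
      simp only [pred]; split_ifs <;> exact ⟨_, _, rfl⟩
    obtain ⟨q, k', hq⟩ := hlast
    rw [hq] at hR hsp hvp ⊢
    have hc := cnt_ge hL q k'
    have hlu : Lg (node p k 0) = lam (up p k) := by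
      change rho (up p k) + 2 = _
      generalize up p k = x; revert x; decide
    rcases hc.2 with h1 | ⟨h1, rfl, rfl | rfl⟩
    · have e1 := remL_step _ _ _ h
      rw [← hlu] at e1
      have e2 := remL_step _ _ _ hd
      have e3 := remL_le j0 (up p k)
      refine Asc.al _ _ _ _ _ hR.symm ?_
      have hLq : Lg (node q k' (cnt L q k')) = lam (Lg (node p k 0)) := by
        have ht : two (node q k' (cnt L q k')) = true := by simp [two]; omega
        unfold Lg
        rw [ht, if_pos rfl, hR]
        rfl
      rw [hLq]
      have hfix := two_eq_of_fix q k' (cnt L q k')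
      rw [hR, hlu] at hfix
      have hop : rho (opp (lam (up p k))) = opp (lam (up p k)) →
          rho (opp (up p k)) = opp (up p k) := by
        generalize up p k = x; revert x; decide
      by_cases hr : rho (up q k') = up q k'
      · have := e3.2 (hop (hfix.2 hr)); omega
      · have := hc.1 hr; omega
    · have hs := succ_last (L := L) (root 0) false
      rw [hsp] at hs
      rw [h1] at hR ⊢
      have hp : p = root 2 := by injection hs
      have hk : k = true := by injection hs
      subst hp hk
      have hj : j' = 2 := by
        clear hR hs hx hlu hvp hsp hq hv hn; revert h hd; revert j0 j j'; decide
      subst hj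
      exact Asc.ax0 _ hR.symm
    · have hs := succ_last (L := L) (root 2) false
      rw [hsp] at hs
      rw [h1] at hR ⊢
      have hp : p = root 1 := by injection hs
      have hk : k = false := by injection hs
      subst hp hk
      have hj : j' = 1 := by
        clear hR hs hx hlu hvp hsp hq hv hn; revert h hd; revert j0 j j'; decide
      subst hj
      exact Asc.ax2 _ hR.symm
  | ar p k i _ _ hl h h0 => exact absurd hl.symm hx
  | al p k i _ _ hl h =>
    have e2 := remL_step _ _ _ hd
    obtain ⟨m, rfl⟩ : ∃ m, i = m + 2 := ⟨i - 2, by omega⟩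
    refine Asc.al p k (m + 1) _ _ hR.symm ?_
    have : Lg (node p k (m + 1)) = lam (Lg (node p k (m + 2))) := by
      change R (node p k (m + 1)) + 3 = _
      have : R (node p k (m + 1)) = opp (Lg (node p k (m + 2))) := hR
      rw [this]; rfl
    rw [this]; omega
  | ax2 _ hl =>
    have hs : pred L (node (root 2) false 0) = node (root 2) true (cnt L (root 2) true) := rfl
    rw [hs] at hR ⊢
    have hj : j' = 0 := by
      clear hR hs hx hl hv hn; revert hd; revert j'; decide
    subst hj
    refine Asc.al _ _ _ _ _ hR.symm ?_
    have h7 := cnt_two_true hL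
    have ht : two (node (root 2) true (cnt L (root 2) true)) = true := by simp [two]; omega
    have : Lg (node (root 2) true (cnt L (root 2) true)) = 1 := by
      unfold Lg
      rw [ht, if_pos rfl, hR]
      rfl
    rw [this]
    change 3 < _
    omega
  | ax0 _ hl => exact absurd hd (by revert j'; decide)

theorem asc_step (hL : Good L) (v : V) (j j' : Fin 3) (l x : Fin 4)
    (hv : valid L v) (ha : Asc L v j l) (hd : del j x = some j') (hx : x ≠ opp l) :
    Asc L (nb L v x) j' x ∧ ht v ≤ ht (nb L v x) := by
  rcases germ_cases v x with ⟨hn, rfl⟩ | ⟨hn, rfl⟩ | ⟨k, hs, rfl⟩ | ⟨p, k, rfl, rfl⟩ |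
    ⟨i, j, rfl, h⟩
  · rw [nb_right v hn]; exact ⟨asc_right hL v j j' l hn hv ha hd hx, (ht_succ v).ge⟩
  · rw [nb_left v hn]; exact ⟨asc_left hL v j j' l hn hv ha hd hx, (ht_pred v).ge⟩
  · rw [nb_up v k hs]; exact ⟨Asc.a0 _ _ _ _ hd, by simp [ht]⟩
  · exfalso
    generalize hw : node p k 0 = w at ha
    cases ha with
    | a0 p' k' j0 _ h =>
      injection hw with h1 h2; subst h1 h2; exact hx rfl
    | ar p' k' i _ _ hl h h0 =>
      injection hw with h1 h2 h3; subst h1 h2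
      rw [h0 h3.symm] at hd; cases hd
    | al p' k' i _ _ hl h =>
      injection hw with h1 h2 h3; subst h3; omega
    | ax2 _ hl =>
      injection hw with h1 h2 h3; subst h1 h2
      exact absurd hd (by revert j'; decide)
    | ax0 _ hl =>
      injection hw with h1 h2 h3; subst h1 h2
      exact absurd hd (by revert j'; decide)
  · cases ha

/-! ### Periodic paths do not exist -/

structure Loop (L : Fin 4 → ℕ) (n : ℕ) (v : ℕ → V) (j : ℕ → Fin 3) (x : ℕ → Fin 4) : Prop where
  hn : 0 < n
  val : ∀ t, valid L (v t)
  off : ∀ t, v t ≠ root (j t)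
  vs : ∀ t, v (t + 1) = nb L (v t) (x t)
  js : ∀ t, del (j t) (x t) = some (j (t + 1))
  red : ∀ t, x (t + 1) ≠ opp (x t)
  pv : ∀ t, v (t + n) = v t
  pj : ∀ t, j (t + n) = j t
  px : ∀ t, x (t + n) = x t

variable {n : ℕ} {v : ℕ → V} {j : ℕ → Fin 3} {x : ℕ → Fin 4}

theorem Loop.no_up (hL : Good L) (l : Loop L n v j x) (t : ℕ) (k : Bool) (hs : slot (v t) k)
    (hx : x t = up (v t) k) : False := by
  have h1 : v (t + 1) = node (v t) k 0 := by rw [l.vs, hx, nb_up _ _ hs]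
  have key : ∀ m, Asc L (v (t + 1 + m)) (j (t + 1 + m)) (x (t + m)) ∧
      ht (v (t + 1)) ≤ ht (v (t + 1 + m)) := by
    intro m
    induction m with
    | zero =>
      refine ⟨?_, le_rfl⟩
      simp only [add_zero]
      rw [h1, hx]
      exact Asc.a0 _ _ (j t) _ (by rw [← hx]; exact l.js t)
    | succ m ih =>
      have e : x (t + 1 + m) ≠ opp (x (t + m)) := by
        rw [show t + 1 + m = t + m + 1 by ring]; exact l.red _
      have := asc_step hL _ _ _ _ _ (l.val _) ih.1 (l.js (t + 1 + m)) e
      rw [← l.vs] at this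
      refine ⟨?_, ih.2.trans this.2⟩
      rw [show t + (m + 1) = t + 1 + m by ring]
      exact this.1
  have h2 := (key (n - 1)).2
  rw [show t + 1 + (n - 1) = t + n by have := l.hn; omega, l.pv, h1] at h2
  simp [ht] at h2

theorem Loop.ht_le (hL : Good L) (l : Loop L n v j x) (t : ℕ) :
    ht (v (t + 1)) ≤ ht (v t) := by
  rw [l.vs]
  rcases germ_cases (v t) (x t) with ⟨hn, h⟩ | ⟨hn, h⟩ | ⟨k, hs, h⟩ | ⟨p, k, h, h'⟩ |
    ⟨i, j, h, h'⟩
  · rw [h, nb_right _ hn, ht_succ]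
  · rw [h, nb_left _ hn, ht_pred]
  · exact (l.no_up hL t k hs h).elim
  · rw [h', h, nb_down]; simp [ht]
  · rw [h, nb_core _ _ _ h']; simp [ht]

theorem Loop.no_down (hL : Good L) (l : Loop L n v j x) (t : ℕ) (p : V) (k : Bool)
    (h : v t = node p k 0) (hx : x t = opp (up p k)) : False := by
  have h1 : v (t + 1) = p := by rw [l.vs, hx, h, nb_down]
  have key : ∀ m, ht (v (t + 1 + m)) ≤ ht (v (t + 1)) := by
    intro m
    induction m with
    | zero => exact le_rfl
    | succ m ih => exact (l.ht_le hL (t + 1 + m)).trans ih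
  have h2 := key (n - 1)
  rw [show t + 1 + (n - 1) = t + n by have := l.hn; omega, l.pv, h1, h] at h2
  simp [ht] at h2

theorem Loop.flat (hL : Good L) (l : Loop L n v j x) (t : ℕ) :
    (isNode (v t) ∧ x t = R (v t)) ∨ (isNode (v t) ∧ x t = Lg (v t)) ∨
    ∃ i i', v t = root i ∧ del i (x t) = some i' := by
  rcases germ_cases (v t) (x t) with h | h | ⟨k, hs, h⟩ | ⟨p, k, h, h'⟩ | h
  · exact Or.inl h
  · exact Or.inr (Or.inl h)
  · exact (l.no_up hL t k hs h).elim
  · exact (l.no_down hL t p k h h').elim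
  · exact Or.inr (Or.inr h)

theorem core_forest : ∀ i j : Fin 3, i ≠ j → ∀ x : Fin 4, ∀ i1, del i x = some i1 →
    ∀ j1, del j x = some j1 → ∀ y, y ≠ opp x → ∀ i2, del i1 y = some i2 → ∀ j2,
    del j1 y = some j2 → ∀ z, z ≠ opp y → del i2 z = none ∨ del j2 z = none := by
  decide

theorem Loop.no_root (hL : Good L) (l : Loop L n v j x) (i : Fin 3) (h : v 0 = root i) : False := by
  have step : ∀ t i, v t = root i → ∃ i', del i (x t) = some i' ∧ v (t + 1) = root i' := by
    intro t i h
    rcases l.flat hL t with ⟨hn, _⟩ | ⟨hn, _⟩ | ⟨a, b, ha, hb⟩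
    · rw [h] at hn; exact hn.elim
    · rw [h] at hn; exact hn.elim
    · rw [h] at ha; injection ha with ha; subst ha
      exact ⟨b, hb, by rw [l.vs, h, nb_core _ _ _ hb]⟩
  obtain ⟨i1, h1, v1⟩ := step 0 i h
  obtain ⟨i2, h2, v2⟩ := step 1 i1 v1
  obtain ⟨i3, h3, v3⟩ := step 2 i2 v2
  have hij : i ≠ j 0 := by rintro rfl; exact l.off 0 h
  rcases core_forest i (j 0) hij (x 0) i1 h1 _ (l.js 0) (x 1) (l.red 0) i2 h2 _ (l.js 1)
    (x 2) (l.red 1) with h | h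
  · rw [h3] at h; cases h
  · rw [l.js 2] at h; cases h

theorem Loop.no_right (hL : Good L) (l : Loop L n v j x)
    (hnode : ∀ t, isNode (v t)) (hx : ∀ t, x t = R (v t)) : False := by
  have hv : ∀ t, v (t + 1) = succ L (v t) := fun t => by rw [l.vs, hx, nb_right _ (hnode t)]
  have rf : ∀ m t p k i, v t = node p k i → i + m = cnt L p k →
      m + 1 ≤ remR (j t) (R (v t)) ∧ ∃ t', v t' = node (nxt L p k).1 (nxt L p k).2 0 := by
    intro m
    induction m with
    | zero =>
      intro t p k i h hi
      have hd := l.js t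
      rw [hx] at hd
      refine ⟨by rw [remR_step _ _ _ hd]; omega, t + 1, ?_⟩
      simp only [add_zero] at hi
      subst hi
      rw [hv, h, succ_last]
    | succ m ih =>
      intro t p k i h hi
      have hd := l.js t
      rw [hx] at hd
      have h1 : v (t + 1) = node p k (i + 1) := by rw [hv, h, succ_lt (by omega)]
      obtain ⟨h2, h3⟩ := ih (t + 1) p k (i + 1) h1 (by omega)
      refine ⟨?_, h3⟩
      rw [remR_step _ _ _ hd]
      rw [h1, R_node_succ, ← h] at h2
      omega
  have rf1 : ∀ t p k, v t = node p k 0 → cnt L p k + 1 ≤ 4 ∧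
      (rho (up p k) = up p k → cnt L p k + 1 ≤ 2) := by
    intro t p k h
    have h1 := (rf (cnt L p k) t p k 0 h (by omega)).1
    have h2 := remR_le (j t) (R (v t))
    refine ⟨h1.trans h2.1, fun h3 => h1.trans (h2.2 ?_)⟩
    rw [h]; exact (two_eq_of_fix p k 0).2 h3
  have rf2 : ∀ t p k, v t = node p k 0 → ∃ t', v t' = node (nxt L p k).1 (nxt L p k).2 0 :=
    fun t p k h => (rf (cnt L p k) t p k 0 h (by omega)).2
  obtain ⟨p, k, i, h0⟩ : ∃ p k i, v 0 = node p k i := by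
    have := hnode 0
    cases h : v 0 with
    | root i => rw [h] at this; exact this.elim
    | node p k i => exact ⟨p, k, i, rfl⟩
  have hval := l.val 0
  rw [h0] at hval
  obtain ⟨t1, h1⟩ := (rf (cnt L p k - i) 0 p k i h0 (by have := hval.2.2; omega)).2
  have nodecase : ∀ t p k, v t = node p k 0 → isNode p → rho (up p k) = up p k := by
    intro t p k h hp
    by_contra hne
    have h2 := (rf1 t p k h).1
    have h3 := cnt_add hL p k
    have h4 : beta p k ≤ 1 := by
      cases p with
      | root i => exact hp.elim
      | node q k' i => cases k <;> simp [beta]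
    rcases L_big hL (up p k) with ⟨h5, _⟩ | ⟨_, h6⟩
    · exact hne h5
    · omega
  cases hp : p with
  | node q k' i' =>
    have hpn : isNode p := by rw [hp]; trivial
    have hnx : ∀ p k, isNode p → isNode (nxt L p k).1 := by
      intro p k hp
      unfold nxt; split_ifs
      · exact hp
      · exact isNode_succ p hp
    have c1 := nodecase _ _ _ h1 (hnx p k hpn)
    obtain ⟨t2, h2⟩ := rf2 _ _ _ h1
    have c2 := nodecase _ _ _ h2 (hnx _ _ (hnx p k hpn))
    have hval1 := l.val t1
    rw [h1] at hval1
    have he := face_end hL _ _ hval1.1 hval1.2.1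
    generalize (nxt L p k).1 = p1 at *
    generalize (nxt L p k).2 = k1 at *
    have c3 := (two_eq_of_fix p1 k1 (cnt L p1 k1)).2 c1
    rw [c3] at he
    rw [he] at c3
    generalize up _ _ = y at c2 c3
    revert y; decide
  | root i =>
    subst hp
    have fin : ∀ t, v t = node (root 2) true 0 → False := by
      intro t h
      have := (rf1 t _ _ h).1
      have := cnt_two_true hL
      omega
    have f0 : ∀ t, v t = node (root 0) false 0 → False := by
      intro t h
      obtain ⟨t', h'⟩ := rf2 _ _ _ h
      exact fin t' h'
    have f1 : ∀ t, v t = node (root 1) false 0 → False := by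
      intro t h
      obtain ⟨t', h'⟩ := rf2 _ _ _ h
      exact f0 t' h'
    have f2 : ∀ t, v t = node (root 2) false 0 → False := by
      intro t h
      obtain ⟨t', h'⟩ := rf2 _ _ _ h
      exact f1 t' h'
    cases k with
    | true =>
      have := hval.2.1 rfl
      have hi : i = 2 := by simpa [two] using this
      subst hi
      exact f2 t1 h1
    | false =>
      fin_cases i
      · exact fin t1 h1
      · exact f0 t1 h1
      · exact f1 t1 h1

theorem Loop.rev (hL : Good L) (l : Loop L n v j x) :
    Loop L n (fun t => v ((n - 1) * t)) (fun t => j ((n - 1) * t))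
      (fun t => opp (x ((n - 1) * (t + 1)))) := by
  obtain ⟨m, rfl⟩ : ∃ m, n = m + 1 := ⟨n - 1, by have := l.hn; omega⟩
  simp only [Nat.add_sub_cancel]
  have pv : ∀ a t, v (t + a * (m + 1)) = v t := by
    intro a; induction a with
    | zero => simp
    | succ a ih => intro t; rw [add_mul, one_mul, ← add_assoc, l.pv, ih]
  have pj : ∀ a t, j (t + a * (m + 1)) = j t := by
    intro a; induction a with
    | zero => simp
    | succ a ih => intro t; rw [add_mul, one_mul, ← add_assoc, l.pj, ih]
  have px : ∀ a t, x (t + a * (m + 1)) = x t := by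
    intro a; induction a with
    | zero => simp
    | succ a ih => intro t; rw [add_mul, one_mul, ← add_assoc, l.px, ih]
  have ev : ∀ t, v (m * t) = v (m * (t + 1) + 1) := by
    intro t; rw [← l.pv]; congr 1
  have ej : ∀ t, j (m * t) = j (m * (t + 1) + 1) := by
    intro t; rw [← l.pj]; congr 1
  have ex : ∀ t, x (m * t) = x (m * (t + 1) + 1) := by
    intro t; rw [← l.px]; congr 1
  refine ⟨l.hn, fun t => l.val _, fun t => l.off _, fun t => ?_, fun t => ?_, fun t => ?_,
    fun t => ?_, fun t => ?_, fun t => ?_⟩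
  · rw [ev t, l.vs (m * (t + 1)), nb_nb hL _ _ (l.val _)]
  · rw [ej t]
    exact del_opp _ _ _ (l.js _)
  · intro h
    simp only [opp_opp] at h
    rw [ex (t + 1)] at h
    apply l.red (m * (t + 1 + 1))
    exact h.symm
  · rw [← pv m (m * t)]; congr 1; ring
  · rw [← pj m (m * t)]; congr 1; ring
  · rw [← px m (m * (t + 1))]; congr 2; ring

theorem no_loop (hL : Good L) (l : Loop L n v j x) : False := by
  cases h0 : v 0 with
  | root i => exact l.no_root hL i h0
  | node p k i =>
    have hnode : ∀ t, isNode (v t) := by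
      intro t
      induction t with
      | zero => rw [h0]; trivial
      | succ t ih =>
        rw [l.vs]
        rcases l.flat hL t with ⟨hn, h⟩ | ⟨hn, h⟩ | ⟨a, b, ha, hb⟩
        · rw [h, nb_right _ hn]; exact isNode_succ _ hn
        · rw [h, nb_left _ hn]; exact isNode_pred _ hn
        · rw [ha] at ih; exact ih.elim
    have dir : ∀ t, x t = R (v t) ∨ x t = Lg (v t) := by
      intro t
      rcases l.flat hL t with ⟨hn, h⟩ | ⟨hn, h⟩ | ⟨a, b, ha, hb⟩
      · exact Or.inl h
      · exact Or.inr h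
      · have := hnode t; rw [ha] at this; exact this.elim
    rcases dir 0 with hr | hl
    · apply l.no_right hL hnode
      intro t
      induction t with
      | zero => exact hr
      | succ t ih =>
        rcases dir (t + 1) with h | h
        · exact h
        · exfalso
          apply l.red t
          rw [h, l.vs, ih, nb_right _ (hnode t), Lg_succ hL _ (hnode t) (l.val t)]
    · have hall : ∀ t, x t = Lg (v t) := by
        intro t
        induction t with
        | zero => exact hl
        | succ t ih =>
          rcases dir (t + 1) with h | h
          · exfalso
            apply l.red t
            rw [h, l.vs, ih, nb_left _ (hnode t), R_pred hL _ (hnode t) (l.val t)]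
          · exact h
      refine (l.rev hL).no_right hL (fun t => hnode _) (fun t => ?_)
      obtain ⟨m, rfl⟩ : ∃ m, n = m + 1 := ⟨n - 1, by have := l.hn; omega⟩
      simp only [Nat.add_sub_cancel]
      have ev : v (m * t) = v (m * (t + 1) + 1) := by
        rw [← l.pv]; congr 1
      rw [ev, l.vs, hall, nb_left _ (hnode _), R_pred hL _ (hnode _) (l.val _)]

end VD

/-! ### Words -/

namespace VD
open V

section words
variable {L : Fin 4 → ℕ} {G : Type*} [Group G]

def ev (ge : Fin 4 → G) (w : List (Fin 4)) : G := (w.map ge).prod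

def vrun (L : Fin 4 → ℕ) : V → List (Fin 4) → V
  | v, [] => v
  | v, x :: w => vrun L (nb L v x) w

def Gr : Fin 3 → List (Fin 4) → Fin 3 → Prop
  | j, [], k => j = k
  | j, x :: w, k => ∃ j', del j x = some j' ∧ Gr j' w k

def rinv (w : List (Fin 4)) : List (Fin 4) := (w.map opp).reverse

theorem ev_append (ge : Fin 4 → G) (u w : List (Fin 4)) : ev ge (u ++ w) = ev ge u * ev ge w := by
  simp [ev]

theorem ev_rinv (ge : Fin 4 → G) (hg : ∀ x, ge (opp x) = (ge x)⁻¹) (w : List (Fin 4)) :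
    ev ge (rinv w) = (ev ge w)⁻¹ := by
  induction w with
  | nil => simp [ev, rinv]
  | cons x w ih =>
    have : rinv (x :: w) = rinv w ++ [opp x] := by simp [rinv]
    rw [this, ev_append, ih]
    simp [ev, hg]

theorem vrun_append (v : V) (u w : List (Fin 4)) :
    vrun L v (u ++ w) = vrun L (vrun L v u) w := by
  induction u generalizing v with
  | nil => rfl
  | cons x u ih => exact ih _

theorem valid_vrun (v : V) (w : List (Fin 4)) (hv : valid L v) : valid L (vrun L v w) := by
  induction w generalizing v with
  | nil => exact hv
  | cons x u ih => exact ih _ (valid_nb _ _ hv)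

theorem Gr_append (i j k : Fin 3) (u w : List (Fin 4)) (h1 : Gr i u j) (h2 : Gr j w k) :
    Gr i (u ++ w) k := by
  induction u generalizing i with
  | nil => cases h1; exact h2
  | cons x u ih =>
    obtain ⟨j', h, h'⟩ := h1
    exact ⟨j', h, ih _ h'⟩

theorem Gr_rinv (i j : Fin 3) (u : List (Fin 4)) (h : Gr i u j) : Gr j (rinv u) i := by
  induction u generalizing i with
  | nil => cases h; rfl
  | cons x u ih =>
    obtain ⟨j', h, h'⟩ := h
    have : rinv (x :: u) = rinv u ++ [opp x] := by simp [rinv]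
    rw [this]
    exact Gr_append _ _ _ _ _ (ih _ h') ⟨i, del_opp _ _ _ h, rfl⟩

theorem vrun_core (i j : Fin 3) (u : List (Fin 4)) (h : Gr i u j) :
    vrun L (root i) u = root j := by
  induction u generalizing i with
  | nil => cases h; rfl
  | cons x u ih =>
    obtain ⟨j', h, h'⟩ := h
    simp only [vrun]
    rw [nb_core _ _ _ h]
    exact ih _ h'

theorem W_vrun {ge : Fin 4 → G} {w : Fin 3 → G} {H : Subgroup G}
    (hL : Good L) (hg : ∀ x, ge (opp x) = (ge x)⁻¹) (hr : ∀ x, pth ge x (L x) = 1)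
    (hw : ∀ i j x, del i x = some j → w i * ge x * (w j)⁻¹ ∈ H)
    (v : V) (u : List (Fin 4)) (hv : valid L v) :
    W ge w v * ev ge u * (W ge w (vrun L v u))⁻¹ ∈ H := by
  induction u generalizing v with
  | nil => simp [ev, vrun, H.one_mem]
  | cons x u ih =>
    have h1 := W_nb hL hg hr hw v x hv
    have h2 := ih (nb L v x) (valid_nb _ _ hv)
    have := H.mul_mem h1 h2
    simpa [ev, vrun, mul_assoc] using this

structure Bad (L : Fin 4 → ℕ) (ge : Fin 4 → G) (S : V × Fin 3 × List (Fin 4)) : Prop where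
  val : valid L S.1
  off : S.1 ≠ root S.2.1
  run : vrun L S.1 S.2.2 = S.1
  gr : Gr S.2.1 S.2.2 S.2.1
  ne : ev ge S.2.2 ≠ 1

def rot (L : Fin 4 → ℕ) : V × Fin 3 × List (Fin 4) → V × Fin 3 × List (Fin 4)
  | (v, j, []) => (v, j, [])
  | (v, j, x :: w) => (nb L v x, (del j x).getD 0, w ++ [x])

theorem rot_many (v : V) (j k : Fin 3) (w1 w2 : List (Fin 4)) (h : Gr j w1 k) :
    (rot L)^[w1.length] (v, j, w1 ++ w2) = (vrun L v w1, k, w2 ++ w1) := by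
  induction w1 generalizing v j w2 with
  | nil => cases h; simp [vrun]
  | cons x w ih =>
    obtain ⟨j', h, h'⟩ := h
    rw [List.length_cons, Function.iterate_succ_apply]
    have : rot L (v, j, x :: w ++ w2) = (nb L v x, j', w ++ (w2 ++ [x])) := by
      simp [rot, h]
    rw [this, ih _ _ _ h']
    simp [vrun]

theorem rot_length (S : V × Fin 3 × List (Fin 4)) : (rot L S).2.2.length = S.2.2.length := by
  obtain ⟨v, j, w⟩ := S
  cases w <;> simp [rot]

theorem bad_rot {ge : Fin 4 → G} (hL : Good L) (S : V × Fin 3 × List (Fin 4))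
    (h : Bad L ge S) : Bad L ge (rot L S) := by
  obtain ⟨v, j, w⟩ := S
  cases w with
  | nil => exact h
  | cons x w =>
    obtain ⟨h1, h2, h3, ⟨j', h4, h5⟩, h6⟩ := h
    have e : rot L (v, j, x :: w) = (nb L v x, j', w ++ [x]) := by
      simp [rot, show del j x = some j' from h4]
    rw [e]
    refine ⟨valid_nb _ _ h1, ?_, ?_, ?_, ?_⟩
    · intro hc
      apply h2
      dsimp only at hc h1 h4 ⊢
      rw [← nb_nb hL v x h1, hc]
      exact nb_core _ _ _ (del_opp _ _ _ h4)
    · dsimp only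
      rw [vrun_append]
      have h3' : vrun L (nb L v x) w = v := h3
      rw [h3']; rfl
    · exact Gr_append _ _ _ _ _ h5 ⟨j', h4, rfl⟩
    · intro hc
      apply h6
      dsimp only at hc ⊢
      rw [ev_append] at hc
      have : ev ge [x] * ev ge w = 1 := by
        rw [mul_eq_one_iff_eq_inv] at hc ⊢
        rw [hc]; simp
      simpa [ev] using this

theorem no_bad {ge : Fin 4 → G} (hL : Good L) (hg : ∀ x, ge (opp x) = (ge x)⁻¹) (n : ℕ) :
    ∀ S : V × Fin 3 × List (Fin 4), S.2.2.length = n → ¬ Bad L ge S := by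
  induction n using Nat.strong_induction_on with
  | _ n ih =>
  intro S hS hB
  have hpos : ∀ T, Bad L ge T → 0 < T.2.2.length := by
    rintro ⟨v, j, w⟩ hT
    cases w with
    | nil => exact absurd rfl hT.ne
    | cons x w => simp
  have hn : 0 < n := hS ▸ hpos S hB
  have hbad : ∀ t, Bad L ge ((rot L)^[t] S) := by
    intro t
    induction t with
    | zero => exact hB
    | succ t iht => rw [Function.iterate_succ_apply']; exact bad_rot hL _ iht
  have hlen : ∀ t, ((rot L)^[t] S).2.2.length = n := by
    intro t
    induction t with
    | zero => exact hS
    | succ t iht => rw [Function.iterate_succ_apply', rot_length, iht]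
  have hper : (rot L)^[n] S = S := by
    obtain ⟨v, j, w⟩ := S
    have := rot_many (L := L) v j j w [] hB.gr
    dsimp only at hS
    rw [hS] at this
    simp only [List.append_nil, List.nil_append] at this
    rw [this]
    have h3 : vrun L v w = v := hB.run
    rw [h3]
  have hper' : ∀ t, (rot L)^[t + n] S = (rot L)^[t] S := by
    intro t; rw [Function.iterate_add_apply, hper]
  have key : ∀ T, Bad L ge T → T.2.2.length = n →
      (rot L T).1 = nb L T.1 (T.2.2.headD 0) ∧
      del T.2.1 (T.2.2.headD 0) = some (rot L T).2.1 ∧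
      (rot L T).2.2.headD 0 ≠ opp (T.2.2.headD 0) := by
    rintro ⟨v, j, w⟩ hT hl
    cases w with
    | nil => exact absurd rfl hT.ne
    | cons x w =>
      obtain ⟨j', h4, h5⟩ := hT.gr
      refine ⟨rfl, ?_, ?_⟩
      · dsimp only at h4
        simp [rot, h4]
      · cases w with
        | nil =>
          change x ≠ opp x
          clear hT hl h4 h5
          revert x; decide
        | cons y w =>
          intro hy
          have hy' : y = opp x := hy
          subst hy'
          apply ih w.length (by simp at hl; omega) (v, j, w) rfl
          obtain ⟨h1, h2, h3, ⟨k, h4, k', h5, h6⟩, h7⟩ := hT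
          refine ⟨h1, h2, ?_, ?_, ?_⟩
          · have h3' : vrun L (nb L (nb L v x) (opp x)) w = v := h3
            rw [nb_nb hL v x h1] at h3'
            exact h3'
          · have := del_opp _ _ _ h4
            dsimp only at h5 this ⊢
            rw [this] at h5
            cases h5
            exact h6
          · intro hc
            apply h7
            dsimp only [ev] at hc ⊢
            simp [hg, hc]
  refine no_loop hL (n := n) (v := fun t => ((rot L)^[t] S).1)
    (j := fun t => ((rot L)^[t] S).2.1) (x := fun t => ((rot L)^[t] S).2.2.headD 0)
    ⟨hn, fun t => (hbad t).val, fun t => (hbad t).off, fun t => ?_, fun t => ?_, fun t => ?_,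
      fun t => ?_, fun t => ?_, fun t => ?_⟩
  · rw [Function.iterate_succ_apply']; exact (key _ (hbad t) (hlen t)).1
  · rw [Function.iterate_succ_apply']; exact (key _ (hbad t) (hlen t)).2.1
  · rw [Function.iterate_succ_apply']; exact (key _ (hbad t) (hlen t)).2.2
  · rw [hper']
  · rw [hper']
  · rw [hper']

end words

/-! ### The action -/

section action
variable {L : Fin 4 → ℕ}

def mv (hL : Good L) (x : Fin 4) : Equiv.Perm {v : V // valid L v} where
  toFun v := ⟨nb L v.1 x, valid_nb _ _ v.2⟩
  invFun v := ⟨nb L v.1 (opp x), valid_nb _ _ v.2⟩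
  left_inv v := Subtype.ext (nb_nb hL v.1 x v.2)
  right_inv v := Subtype.ext (by
    have := nb_nb hL v.1 (opp x) v.2
    rwa [opp_opp] at this)

theorem mv_opp (hL : Good L) (x : Fin 4) : mv hL (opp x) = (mv hL x)⁻¹ := by
  ext v; rfl

theorem mv_pow (hL : Good L) (x : Fin 4) (hx : rho x = x) : mv hL x ^ L x = 1 := by
  have h : ∀ n (v : {v : V // valid L v}), (phi L)^[n] (v.1, x) = (((mv hL x ^ n) v).1, x) := by
    intro n v
    induction n with
    | zero => rfl
    | succ n ih =>
      rw [Function.iterate_succ_apply', ih, pow_succ']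
      simp only [phi, hx]; rfl
  ext v
  have h1 := per_all hL v.1 x v.2
  unfold Per at h1
  rw [h] at h1
  exact congrArg (fun z => z.1) h1

theorem mv_pow2 (hL : Good L) (P : ℕ) (hP : L 0 = 2 * P) : (mv hL 2 * mv hL 0) ^ P = 1 := by
  have h : ∀ n (v : {v : V // valid L v}),
      (phi L)^[2 * n] (v.1, 0) = ((((mv hL 2 * mv hL 0) ^ n) v).1, 0) := by
    intro n v
    induction n with
    | zero => rfl
    | succ n ih =>
      rw [show 2 * (n + 1) = 2 * n + 1 + 1 by ring, Function.iterate_succ_apply',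
        Function.iterate_succ_apply', ih, pow_succ']
      simp only [phi, show rho 0 = 2 by decide, show rho 2 = 0 by decide]
      rfl
  ext v
  have h1 := per_all hL v.1 0 v.2
  unfold Per at h1
  rw [hP, h] at h1
  exact congrArg (fun z => z.1) h1

def gens (hL : Good L) : Fin 3 → Equiv.Perm {v : V // valid L v} :=
  ![mv hL 1, mv hL 3, mv hL 2 * mv hL 0]

theorem gens_rel (hL : Good L) (M N P : ℕ) (h0 : L 0 = 2 * P) (h1 : L 1 = M) (h3 : L 3 = N) :
    ∀ r ∈ vonDyckRels M N P, FreeGroup.lift (gens hL) r = 1 := by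
  intro r hr
  rcases hr with rfl | rfl | rfl | rfl
  · rw [map_pow, FreeGroup.lift_apply_of, ← h1]; exact mv_pow hL 1 rfl
  · rw [map_pow, FreeGroup.lift_apply_of, ← h3]; exact mv_pow hL 3 rfl
  · rw [map_pow, FreeGroup.lift_apply_of]; exact mv_pow2 hL P h0
  · rw [map_mul, map_mul, FreeGroup.lift_apply_of, FreeGroup.lift_apply_of,
      FreeGroup.lift_apply_of]
    change mv hL (opp 0) * mv hL (opp 2) * (mv hL 2 * mv hL 0) = 1
    rw [mv_opp, mv_opp]; group

def ge (M N P : ℕ) : Fin 4 → VonDyck M N P :=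
  ![PresentedGroup.of 0, (PresentedGroup.of 0)⁻¹, PresentedGroup.of 1, (PresentedGroup.of 1)⁻¹]

theorem ge_opp (M N P : ℕ) (x : Fin 4) : ge M N P (opp x) = (ge M N P x)⁻¹ := by
  fin_cases x <;> simp [ge, opp]

theorem vrun_congr (hL : Good L) (M N P : ℕ) (h0 : L 0 = 2 * P) (h1 : L 1 = M) (h3 : L 3 = N)
    (v : V) (hv : valid L v) (u w : List (Fin 4)) (h : ev (ge M N P) u = ev (ge M N P) w) :
    vrun L v u = vrun L v w := by
  let θ : VonDyck M N P →* Equiv.Perm {v : V // valid L v} :=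
    PresentedGroup.toGroup (gens_rel hL M N P h0 h1 h3)
  have hθ0 : θ (PresentedGroup.of 0) = mv hL 1 := PresentedGroup.toGroup.of _
  have hθ1 : θ (PresentedGroup.of 1) = mv hL 3 := PresentedGroup.toGroup.of _
  have hθ : ∀ x, θ (ge M N P x) = (mv hL x)⁻¹ := by
    intro x
    rw [← mv_opp]
    fin_cases x
    · exact hθ0
    · change θ (PresentedGroup.of 0)⁻¹ = mv hL (opp 1)
      rw [map_inv, hθ0, mv_opp]
    · exact hθ1
    · change θ (PresentedGroup.of 1)⁻¹ = mv hL (opp 3)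
      rw [map_inv, hθ1, mv_opp]
  have key : ∀ (u : List (Fin 4)) (v : {v : V // valid L v}),
      vrun L v.1 u = ((θ (ev (ge M N P) u))⁻¹ v).1 := by
    intro u
    induction u with
    | nil => intro v; simp [ev, vrun]
    | cons x u ih =>
      intro v
      have : ev (ge M N P) (x :: u) = ge M N P x * ev (ge M N P) u := by simp [ev]
      rw [this, map_mul, hθ, mul_inv_rev, inv_inv]
      exact ih (mv hL x v)
  rw [key u ⟨v, hv⟩, key w ⟨v, hv⟩, h]

theorem ev_surj (M N P : ℕ) (g : VonDyck M N P) : ∃ u, ev (ge M N P) u = g := by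
  have ha : (PresentedGroup.of 0 : VonDyck M N P) ^ M = 1 :=
    PresentedGroup.one_of_mem (rels := vonDyckRels M N P) (x := FreeGroup.of 0 ^ M) (Or.inl rfl)
  have habc : (PresentedGroup.of 0 * PresentedGroup.of 1 * PresentedGroup.of 2 :
      VonDyck M N P) = 1 :=
    PresentedGroup.one_of_mem (rels := vonDyckRels M N P)
      (x := FreeGroup.of 0 * FreeGroup.of 1 * FreeGroup.of 2) (by simp [vonDyckRels])
  have hg : g ∈ Subgroup.closure
      (Set.range (PresentedGroup.of : Fin 3 → VonDyck M N P)) := by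
    rw [PresentedGroup.closure_range_of]; trivial
  induction hg using Subgroup.closure_induction with
  | mem x hx =>
    obtain ⟨i, rfl⟩ := hx
    fin_cases i
    · exact ⟨[0], by simp [ev, ge]⟩
    · exact ⟨[2], by simp [ev, ge]⟩
    · refine ⟨[3, 1], ?_⟩
      have := eq_inv_of_mul_eq_one_right habc
      simp only [ev, ge]
      simpa using this.symm
  | one => exact ⟨[], rfl⟩
  | mul x y _ _ hx hy =>
    obtain ⟨u, rfl⟩ := hx
    obtain ⟨w, rfl⟩ := hy
    exact ⟨u ++ w, ev_append _ _ _⟩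
  | inv x _ hx =>
    obtain ⟨u, rfl⟩ := hx
    exact ⟨rinv u, ev_rinv _ (ge_opp M N P) _⟩

end action

end VD

theorem vonDyck_subgroup_malnormal (M N P : ℕ) (hM : 5 ≤ M) (hN : 5 ≤ N) (hP : 5 ≤ P)
    (hMo : Odd M) (hNo : Odd N) (hPo : Odd P) :
    ∀ g : VonDyck M N P,
      g ∉ Subgroup.closure
        ({(PresentedGroup.of 0) * (PresentedGroup.of 1)⁻¹,
          (PresentedGroup.of 2)⁻¹ * (PresentedGroup.of 0)} : Set (VonDyck M N P)) →
      ∀ x : VonDyck M N P,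
        x ∈ Subgroup.closure
          ({(PresentedGroup.of 0) * (PresentedGroup.of 1)⁻¹,
            (PresentedGroup.of 2)⁻¹ * (PresentedGroup.of 0)} : Set (VonDyck M N P)) →
        g * x * g⁻¹ ∈ Subgroup.closure
          ({(PresentedGroup.of 0) * (PresentedGroup.of 1)⁻¹,
            (PresentedGroup.of 2)⁻¹ * (PresentedGroup.of 0)} : Set (VonDyck M N P)) →
        x = 1 := by
  open VD in
  intro g hg x hx hgx
  set H := Subgroup.closure
          ({(PresentedGroup.of 0) * (PresentedGroup.of 1)⁻¹,
            (PresentedGroup.of 2)⁻¹ * (PresentedGroup.of 0)} : Set (VonDyck M N P)) with hH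
  by_contra hx1
  let L : Fin 4 → ℕ := ![2 * P, M, 2 * P, N]
  have hL : Good L := by
    refine ⟨?_, ?_, rfl, even_two_mul P⟩
    · intro x
      fin_cases x
      · change 5 ≤ 2 * P; omega
      · exact hM
      · change 5 ≤ 2 * P; omega
      · exact hN
    · change 10 ≤ 2 * P; omega
  have ha : (PresentedGroup.of 0 : VonDyck M N P) ^ M = 1 :=
    PresentedGroup.one_of_mem (rels := vonDyckRels M N P) (x := FreeGroup.of 0 ^ M)
      (by simp [vonDyckRels])
  have hb : (PresentedGroup.of 1 : VonDyck M N P) ^ N = 1 :=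
    PresentedGroup.one_of_mem (rels := vonDyckRels M N P) (x := FreeGroup.of 1 ^ N)
      (by simp [vonDyckRels])
  have hc : (PresentedGroup.of 2 : VonDyck M N P) ^ P = 1 :=
    PresentedGroup.one_of_mem (rels := vonDyckRels M N P) (x := FreeGroup.of 2 ^ P)
      (by simp [vonDyckRels])
  have habc : (PresentedGroup.of 0 * PresentedGroup.of 1 * PresentedGroup.of 2 :
      VonDyck M N P) = 1 :=
    PresentedGroup.one_of_mem (rels := vonDyckRels M N P)
      (x := FreeGroup.of 0 * FreeGroup.of 1 * FreeGroup.of 2) (by simp [vonDyckRels])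
  have hci : (PresentedGroup.of 2 : VonDyck M N P)⁻¹ =
      PresentedGroup.of 0 * PresentedGroup.of 1 := (eq_inv_of_mul_eq_one_left habc).symm
  have hgo := ge_opp M N P
  have hab : (PresentedGroup.of 0 * PresentedGroup.of 1 : VonDyck M N P) ^ P = 1 := by
    rw [← hci, inv_pow, hc, inv_one]
  have hba : (PresentedGroup.of 1 * PresentedGroup.of 0 : VonDyck M N P) ^ P = 1 := by
    have e : (PresentedGroup.of 1 * PresentedGroup.of 0 : VonDyck M N P) =
        (PresentedGroup.of 0)⁻¹ * (PresentedGroup.of 0 * PresentedGroup.of 1) *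
          ((PresentedGroup.of 0)⁻¹)⁻¹ := by group
    rw [e, conj_pow, hab]; group
  have p1 : ∀ (y : Fin 4), rho y = y → ∀ n, pth (ge M N P) y n = ge M N P y ^ n := by
    intro y hy n
    induction n with
    | zero => simp [pth]
    | succ n ih => rw [pth, ih, Function.iterate_fixed hy, pow_succ]
  have p2 : ∀ (y : Fin 4), rho (rho y) = y → ∀ n, pth (ge M N P) y (2 * n) =
      (ge M N P y * ge M N P (rho y)) ^ n := by
    intro y hy n
    induction n with
    | zero => simp [pth]
    | succ n ih =>
      have h2 : rho^[2 * n] y = y := by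
        rw [Function.iterate_mul]; exact Function.iterate_fixed hy n
      rw [show 2 * (n + 1) = 2 * n + 1 + 1 by ring, pth, pth, ih,
        Function.iterate_succ_apply', h2, pow_succ, mul_assoc]
  have hr : ∀ y, pth (ge M N P) y (L y) = 1 := by
    intro y
    fin_cases y
    · exact (p2 0 rfl P).trans hab
    · refine (p1 1 rfl M).trans ?_
      change ((PresentedGroup.of 0 : VonDyck M N P)⁻¹) ^ M = 1
      rw [inv_pow, ha, inv_one]
    · exact (p2 2 rfl P).trans hba
    · refine (p1 3 rfl N).trans ?_
      change ((PresentedGroup.of 1 : VonDyck M N P)⁻¹) ^ N = 1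
      rw [inv_pow, hb, inv_one]
  let cw : Fin 3 → VonDyck M N P :=
    ![1, PresentedGroup.of 0, PresentedGroup.of 0 * PresentedGroup.of 1]
  have m1 : (PresentedGroup.of 0 : VonDyck M N P) * (PresentedGroup.of 1)⁻¹ ∈ H :=
    Subgroup.subset_closure (by simp)
  have m2 : (PresentedGroup.of 0 : VonDyck M N P) * PresentedGroup.of 1 *
      PresentedGroup.of 0 ∈ H := by
    rw [← hci]
    exact Subgroup.subset_closure (by simp)
  have hw : ∀ i j y, del i y = some j → cw i * ge M N P y * (cw j)⁻¹ ∈ H := by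
    have m1' := H.inv_mem m1
    have m2' := H.inv_mem m2
    intro i j y h
    fin_cases i <;> fin_cases y <;> simp [del] at h <;> subst h <;>
      simp [cw, ge, H.one_mem] <;> simp [mul_assoc] at m1 m2 m1' m2' <;>
      simp [mul_assoc, m1, m2, m1', m2']
  have hword : ∀ y ∈ H, ∃ u, ev (ge M N P) u = y ∧ Gr 0 u 0 := by
    intro y hy
    induction hy using Subgroup.closure_induction with
    | mem y hy =>
      rcases hy with rfl | rfl
      · exact ⟨[0, 3], by simp [ev, ge], 1, rfl, 0, rfl, rfl⟩
      · refine ⟨[0, 2, 0], ?_, 1, rfl, 2, rfl, 0, rfl, rfl⟩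
        rw [hci]; simp [ev, ge, mul_assoc]
    | one => exact ⟨[], rfl, rfl⟩
    | mul y z _ _ hy hz =>
      obtain ⟨u, rfl, hu⟩ := hy
      obtain ⟨w, rfl, hw⟩ := hz
      exact ⟨u ++ w, ev_append _ _ _, Gr_append _ _ _ _ _ hu hw⟩
    | inv y _ hy =>
      obtain ⟨u, rfl, hu⟩ := hy
      exact ⟨rinv u, ev_rinv _ hgo _, Gr_rinv _ _ _ hu⟩
  obtain ⟨u, rfl⟩ := ev_surj M N P g
  obtain ⟨w, rfl, hgw⟩ := hword x hx
  obtain ⟨w', hw', hgw'⟩ := hword _ hgx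
  have hv0 : valid L (V.root 0) := trivial
  refine no_bad (ge := ge M N P) hL hgo _ (vrun L (V.root 0) u, 0, w) rfl
    ⟨valid_vrun _ _ hv0, ?_, ?_, hgw, hx1⟩
  · intro h
    apply hg
    have := W_vrun hL hgo hr hw (V.root 0) u hv0
    dsimp only at h
    rw [h] at this
    simpa [W, cw] using this
  · dsimp only
    rw [← vrun_append, vrun_congr hL M N P rfl rfl rfl _ hv0 (u ++ w) (w' ++ u),
      vrun_append, vrun_core _ _ _ hgw']
    rw [ev_append, ev_append, hw']; group
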